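/- For Re(1-a) > 0, Re(d) > 0, Re(s) > 0, ∫₀^∞ e^{-st} t^{-a} ₂F₂(a, d+1; c+1, d; st/2) dt = (s^{a-1} Γ(1/2) Γ(1-a) Γ(c+1) / 2^c) · { (2/d) / (Γ((a+c)/2) Γ((c-a+1)/2)) + (1 - c/d) / (Γ((a+c+1)/2) Γ((c-a)/2 + 1)) }. -/

import Mathlib

open Complex Set MeasureTheory

/-- Pochhammer symbol `(a)_n` on the complex numbers. -/
noncomputable def poch (a : ℂ) (n : ℕ) : ℂ := (ascPochhammer ℂ n).eval a

/-- Generalized hypergeometric series with numerator parameters `as` and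
denominator parameters `bs`, evaluated at `z`. -/
noncomputable def hyp (as bs : List ℂ) (z : ℂ) : ℂ :=
  ∑' n : ℕ, ((as.map fun a => poch a n).prod /
    ((bs.map fun b => poch b n).prod * (n.factorial : ℂ))) * z ^ n

open Filter Topology

section Pochhammer

lemma poch_zero (a : ℂ) : poch a 0 = 1 := by simp [poch]

lemma poch_succ (a : ℂ) (n : ℕ) : poch a (n + 1) = poch a n * (a + n) :=
  ascPochhammer_succ_eval n a

lemma poch_succ_left (a : ℂ) (n : ℕ) : poch a (n + 1) = a * poch (a + 1) n := by
  simp [poch, ascPochhammer_succ_left, Polynomial.eval_comp]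

lemma mul_poch_add_one (a : ℂ) (n : ℕ) : a * poch (a + 1) n = poch a n * (a + n) := by
  rw [← poch_succ_left, poch_succ]

lemma poch_ne_zero {b : ℂ} (hb : ∀ n : ℕ, b ≠ -(n : ℂ)) (n : ℕ) : poch b n ≠ 0 := by
  induction n with
  | zero => simp [poch_zero]
  | succ n ih =>
    rw [poch_succ]
    exact mul_ne_zero ih fun h => hb n (eq_neg_of_add_eq_zero_left h)

lemma ne_neg_natCast_add {b : ℂ} (hb : ∀ n : ℕ, b ≠ -(n : ℂ)) (k : ℕ) :
    ∀ n : ℕ, b + k ≠ -(n : ℂ) := by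
  intro n h
  apply hb (n + k)
  push_cast
  linear_combination h

lemma add_natCast_ne_zero {b : ℂ} (hb : ∀ n : ℕ, b ≠ -(n : ℂ)) (n : ℕ) : b + n ≠ 0 :=
  fun h => hb n (eq_neg_of_add_eq_zero_left h)

end Pochhammer

section RatioTest

lemma summable_of_eventually_eq_mul {f r : ℕ → ℂ} {l : ℂ} (hl : ‖l‖ < 1)
    (hr : Tendsto r atTop (𝓝 l)) (h : ∀ᶠ n in atTop, f (n + 1) = r n * f n) : Summable f := by
  obtain ⟨q, hq₁, hq₂⟩ := exists_between hl
  refine summable_of_ratio_norm_eventually_le hq₂ ?_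
  filter_upwards [h, hr.norm.eventually_lt_const hq₁] with n hn hn'
  rw [hn, norm_mul]
  gcongr

lemma tendsto_inv_add_natCast (b : ℂ) :
    Tendsto (fun n : ℕ => (b + (n : ℂ))⁻¹) atTop (𝓝 0) := by
  refine tendsto_inv₀_cobounded.comp ?_
  refine (tendsto_const_add_cobounded b).comp ?_
  rw [← tendsto_norm_atTop_iff_cobounded]
  simpa using tendsto_natCast_atTop_atTop (R := ℝ)

lemma tendsto_add_div_add_natCast (a b : ℂ) :
    Tendsto (fun n : ℕ => (a + (n : ℂ)) / (b + n)) atTop (𝓝 1) := by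
  have h := ((tendsto_inv_add_natCast b).const_mul (a - b)).const_add 1
  rw [mul_zero, add_zero] at h
  refine h.congr' ?_
  have h1 : ∀ᶠ n : ℕ in atTop, (n : ℂ) ≠ -b := by
    have : Tendsto (fun n : ℕ => (n : ℂ)) atTop (Bornology.cobounded ℂ) := by
      rw [← tendsto_norm_atTop_iff_cobounded]
      simpa using tendsto_natCast_atTop_atTop (R := ℝ)
    exact this.eventually_ne_cobounded _
  filter_upwards [h1] with n hn
  have : b + n ≠ 0 := fun h => hn (by linear_combination h)
  field_simp
  ring

end RatioTest

section Bailey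

/-- The terms of the Gauss series `₂F₁(a, p; b; 1/2)`. -/
noncomputable def gaussTerm (a p b : ℂ) (n : ℕ) : ℂ :=
  poch a n * poch p n / (poch b n * n.factorial) * (1 / 2) ^ n

lemma gaussTerm_succ (a p b : ℂ) (n : ℕ) :
    gaussTerm a p b (n + 1) =
      ((a + n) / (b + n) * ((p + n) / (1 + n)) * (1 / 2)) * gaussTerm a p b n := by
  simp only [gaussTerm, poch_succ, Nat.factorial_succ, pow_succ, Nat.cast_mul, Nat.cast_succ,
    div_eq_mul_inv, mul_inv]
  ring_nf

lemma summable_gaussTerm (a p b : ℂ) : Summable (gaussTerm a p b) := by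
  refine summable_of_eventually_eq_mul (l := 1 * 1 * (1 / 2)) (by norm_num)
    (((tendsto_add_div_add_natCast a b).mul (tendsto_add_div_add_natCast p 1)).mul_const _)
    (Eventually.of_forall (gaussTerm_succ a p b))

lemma summable_natCast_mul_gaussTerm (a p b : ℂ) :
    Summable fun n : ℕ => (n : ℂ) * gaussTerm a p b n := by
  refine summable_of_eventually_eq_mul (l := 1 * (1 * 1 * (1 / 2))) (by norm_num)
    ((tendsto_add_div_add_natCast 1 0).mul
    (((tendsto_add_div_add_natCast a b).mul (tendsto_add_div_add_natCast p 1)).mul_const _)) ?_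
  filter_upwards [eventually_ne_atTop 0] with n hn
  have : (n : ℂ) ≠ 0 := by exact_mod_cast hn
  rw [gaussTerm_succ, Nat.cast_succ, zero_add]
  generalize (a + n) / (b + n) * ((p + n) / (1 + n)) * (1 / 2) = x
  field_simp
  ring

lemma gaussTerm_eq_mul_gaussTerm_add_one (a p : ℂ) {b : ℂ} (hb : ∀ n : ℕ, b ≠ -(n : ℂ)) (n : ℕ) :
    b * gaussTerm a p b n = (b + n) * gaussTerm a p (b + 1) n := by
  have h1 := poch_ne_zero hb n
  have h2 := poch_ne_zero (fun n => by simpa using ne_neg_natCast_add hb 1 n) n (b := b + 1)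
  have h3 := mul_poch_add_one b n
  have h4 : (n.factorial : ℂ) ≠ 0 := by exact_mod_cast n.factorial_ne_zero
  simp only [gaussTerm]
  field_simp
  linear_combination poch a n * poch p n * h3

lemma add_one_mul_tsum_gaussTerm (a c : ℂ) (hc : ∀ n : ℕ, c + 1 ≠ -(n : ℂ)) :
    (c + 1) * ∑' n : ℕ, (c + n) * gaussTerm a (1 - a) (c + 1) n =
      (c + a) * (c + 1 - a) * ∑' n, gaussTerm a (1 - a) (c + 2) n := by
  set v := gaussTerm a (1 - a) (c + 1)
  set u := gaussTerm a (1 - a) (c + 2) with hu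
  have huv (n : ℕ) : (c + 1) * v n = (c + 1 + n) * u n := by
    have := gaussTerm_eq_mul_gaussTerm_add_one a (1 - a) hc n
    rwa [show c + 1 + 1 = c + 2 by ring] at this
  have hv : Summable fun n : ℕ => (c + n) * v n := by
    simpa only [add_mul] using
      ((summable_gaussTerm a (1 - a) (c + 1)).mul_left c).add
        (summable_natCast_mul_gaussTerm a (1 - a) (c + 1))
  have hus : Summable u := summable_gaussTerm a (1 - a) (c + 2)
  set G : ℕ → ℂ := fun n => -2 * (c + 1) * (n * v n) with hG
  have hG0 : Tendsto G atTop (𝓝 0) := by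
    simpa only [mul_zero] using
      (summable_natCast_mul_gaussTerm a (1 - a) (c + 1)).tendsto_atTop_zero.const_mul (-2 * (c + 1))
  have hstep (n : ℕ) : (c + 1) * ((c + n) * v n) - (c + a) * (c + 1 - a) * u n
      = G (n + 1) - G n := by
    have h1 := huv n
    have h2 := huv (n + 1)
    have h3 : u (n + 1) = _ := gaussTerm_succ a (1 - a) (c + 2) n
    have h4 : c + 2 + n ≠ 0 := by
      have := add_natCast_ne_zero hc (n + 1)
      push_cast at this
      intro h; apply this; linear_combination h
    have h5 : (1 + n : ℂ) ≠ 0 := by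
      rw [add_comm]; exact_mod_cast n.succ_ne_zero
    rw [← hu] at h3
    have h6 : (n + 1 : ℂ) * (c + 2 + n) * u (n + 1) = (a + n) * (1 - a + n) * (1 / 2) * u n := by
      rw [h3]; field_simp; ring
    simp only [hG]
    push_cast at h2 ⊢
    linear_combination (c - n) * h1 - (-2) * (n + 1) * h2 + 2 * h6
  have hs := (hv.mul_left (c + 1)).sub (hus.mul_left ((c + a) * (c + 1 - a)))
  have hsum := hs.hasSum.tendsto_sum_nat
  simp_rw [Finset.sum_congr rfl fun k _ => hstep k, Finset.sum_range_sub] at hsum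
  have h0 := tendsto_nhds_unique hsum (hG0.sub_const (G 0))
  rw [(hv.mul_left (c + 1)).tsum_sub (hus.mul_left _), tsum_mul_left, tsum_mul_left] at h0
  simp only [hG] at h0
  linear_combination h0

lemma mul_tsum_gaussTerm (a b : ℂ) (hb : ∀ n : ℕ, b ≠ -(n : ℂ)) :
    b * (b + 1) * ∑' n, gaussTerm a (1 - a) b n =
      (b + a) * (b + 1 - a) * ∑' n, gaussTerm a (1 - a) (b + 2) n := by
  rw [← add_one_mul_tsum_gaussTerm a b (fun n => by simpa using ne_neg_natCast_add hb 1 n),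
    mul_comm b, mul_assoc, ← tsum_mul_left]
  simp_rw [gaussTerm_eq_mul_gaussTerm_add_one a (1 - a) hb]

lemma tsum_gaussTerm_eq_prod (a b : ℂ) (hb : ∀ n : ℕ, b ≠ -(n : ℂ)) (n : ℕ) :
    ∑' k, gaussTerm a (1 - a) b k =
      (∏ j ∈ Finset.range n, ((b + a) / 2 + j) * ((b - a + 1) / 2 + j) /
        ((b / 2 + j) * ((b + 1) / 2 + j))) * ∑' k, gaussTerm a (1 - a) (b + 2 * n) k := by
  induction n with
  | zero => simp
  | succ n ih =>
    rw [ih, Finset.prod_range_succ, mul_assoc]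
    congr 1
    have h := mul_tsum_gaussTerm a (b + 2 * n)
      (fun k => by simpa using ne_neg_natCast_add hb (2 * n) k)
    have h1 := add_natCast_ne_zero hb (2 * n)
    have h2 := add_natCast_ne_zero hb (2 * n + 1)
    push_cast at h1 h2 ⊢
    rw [show b + 2 * (n + 1 : ℂ) = b + 2 * n + 2 by ring]
    have h3 : b / 2 + n ≠ 0 := fun h => h1 (by linear_combination 2 * h)
    have h4 : (b + 1) / 2 + n ≠ 0 := fun h => h2 (by linear_combination 2 * h)
    rw [div_mul_eq_mul_div, eq_div_iff (mul_ne_zero h3 h4)]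
    linear_combination h / 4

lemma factorial_le_norm_poch {b : ℂ} (hb : 1 ≤ b.re) (n : ℕ) :
    (n.factorial : ℝ) ≤ ‖poch b n‖ := by
  induction n with
  | zero => simp [poch_zero]
  | succ n ih =>
    rw [poch_succ, Nat.factorial_succ, norm_mul, mul_comm, Nat.cast_mul]
    gcongr
    refine le_trans ?_ (Complex.re_le_norm _)
    simp
    linarith

lemma re_mul_factorial_le_norm_poch_succ {b : ℂ} (hb : 1 ≤ b.re) (n : ℕ) :
    b.re * n.factorial ≤ ‖poch b (n + 1)‖ := by
  rw [poch_succ_left, norm_mul]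
  gcongr
  · exact Complex.re_le_norm _
  · refine factorial_le_norm_poch ?_ n
    simp
    linarith

lemma tendsto_tsum_gaussTerm (a p b : ℂ) :
    Tendsto (fun n : ℕ => ∑' k, gaussTerm a p (b + 2 * n) k) atTop (𝓝 1) := by
  have hre : Tendsto (fun n : ℕ => (b + 2 * n : ℂ).re) atTop atTop := by
    simp only [Complex.add_re, Complex.mul_re, Complex.re_ofNat, Complex.natCast_re,
      Complex.im_ofNat, Complex.natCast_im, mul_zero, sub_zero]
    exact tendsto_atTop_add_const_left _ _
      (tendsto_natCast_atTop_atTop.const_mul_atTop (by norm_num))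
  have hpoch1 (n : ℕ) : poch 1 n = n.factorial := by
    induction n with
    | zero => simp [poch_zero]
    | succ n ih => rw [poch_succ, ih, Nat.factorial_succ]; push_cast; ring
  have key := tendsto_tsum_of_dominated_convergence (𝓕 := atTop)
    (f := fun (n : ℕ) k => gaussTerm a p (b + 2 * n) k)
    (g := fun k => if k = 0 then (1 : ℂ) else 0)
    (summable_gaussTerm a p 1).norm ?_ ?_
  · simpa using key
  · rintro (_ | k)
    · simp [gaussTerm, poch_zero]
    · simp only [Nat.succ_ne_zero, if_false]
      have hinv : Tendsto (fun n : ℕ => (poch (b + 2 * n) (k + 1))⁻¹) atTop (𝓝 0) := by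
        refine tendsto_inv₀_cobounded.comp ?_
        rw [← tendsto_norm_atTop_iff_cobounded]
        refine tendsto_atTop_mono' _ ?_
          (hre.atTop_mul_const (r := (k.factorial : ℝ)) (by positivity))
        filter_upwards [hre.eventually_ge_atTop 1] with n hn
        exact re_mul_factorial_le_norm_poch_succ hn k
      have := hinv.const_mul (poch a (k + 1) * poch p (k + 1) * ((k + 1).factorial : ℂ)⁻¹ *
        (1 / 2) ^ (k + 1))
      rw [mul_zero] at this
      refine this.congr fun n => ?_
      simp only [gaussTerm, div_eq_mul_inv, mul_inv]
      ring
  · filter_upwards [hre.eventually_ge_atTop 1] with n hn k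
    have h1 := factorial_le_norm_poch hn k
    simp only [gaussTerm, norm_mul, norm_div, hpoch1, Complex.norm_natCast]
    gcongr

lemma tendsto_prod_div_of_add_eq {x y z w : ℂ} (hx : ∀ n : ℕ, x ≠ -(n : ℂ))
    (hy : ∀ n : ℕ, y ≠ -(n : ℂ)) (h : x + y = z + w) :
    Tendsto (fun n : ℕ => ∏ j ∈ Finset.range (n + 1), (z + j) * (w + j) / ((x + j) * (y + j)))
      atTop (𝓝 (Gamma x * Gamma y / (Gamma z * Gamma w))) := by
  have hzero {z : ℂ} {m : ℕ} (hz : z = -(m : ℂ)) (w : ℂ) :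
      ∀ᶠ n : ℕ in atTop, ∏ j ∈ Finset.range (n + 1),
        (z + j) * (w + j) / ((x + j) * (y + j)) = 0 := by
    filter_upwards [eventually_ge_atTop m] with n hn
    exact Finset.prod_eq_zero (i := m) (by simp; omega) (by simp [hz])
  by_cases hz : ∃ m : ℕ, z = -(m : ℂ)
  · have h0 : Gamma z = 0 := (Gamma_eq_zero_iff z).2 hz
    obtain ⟨m, hm⟩ := hz
    rw [h0, zero_mul, div_zero]
    exact tendsto_const_nhds.congr' ((hzero hm w).mono fun n hn => hn.symm)
  by_cases hw : ∃ m : ℕ, w = -(m : ℂ)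
  · have h0 : Gamma w = 0 := (Gamma_eq_zero_iff w).2 hw
    obtain ⟨m, hm⟩ := hw
    rw [h0, mul_zero, div_zero]
    refine tendsto_const_nhds.congr' ((hzero hm z).mono fun n hn => ?_)
    simp_rw [mul_comm (z + _)]
    exact hn.symm
  push Not at hz hw
  refine (((GammaSeq_tendsto_Gamma x).mul (GammaSeq_tendsto_Gamma y)).div
    ((GammaSeq_tendsto_Gamma z).mul (GammaSeq_tendsto_Gamma w))
    (mul_ne_zero (Gamma_ne_zero hz) (Gamma_ne_zero hw))).congr' ?_
  filter_upwards [eventually_ne_atTop 0] with n hn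
  have hn' : (n : ℂ) ≠ 0 := by exact_mod_cast hn
  have hf : (n.factorial : ℂ) ≠ 0 := by exact_mod_cast n.factorial_ne_zero
  have hp {x : ℂ} (hx : ∀ n : ℕ, x ≠ -(n : ℂ)) :
      ∏ j ∈ Finset.range (n + 1), (x + j) ≠ 0 :=
    Finset.prod_ne_zero_iff.2 fun j _ => add_natCast_ne_zero hx j
  have hpow : (n : ℂ) ^ x * (n : ℂ) ^ y = (n : ℂ) ^ z * (n : ℂ) ^ w := by
    rw [← cpow_add _ _ hn', ← cpow_add _ _ hn', h]
  have e1 : (n : ℂ) ^ z ≠ 0 := by simp [cpow_eq_zero_iff, hn']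
  have e2 : (n : ℂ) ^ w ≠ 0 := by simp [cpow_eq_zero_iff, hn']
  have p1 := hp hx
  have p2 := hp hy
  have p3 := hp hz
  have p4 := hp hw
  simp only [Finset.prod_div_distrib, Finset.prod_mul_distrib]
  simp only [Pi.div_apply, GammaSeq]
  generalize ∏ j ∈ Finset.range (n + 1), (x + (j : ℂ)) = X at *
  generalize ∏ j ∈ Finset.range (n + 1), (y + (j : ℂ)) = Y at *
  generalize ∏ j ∈ Finset.range (n + 1), (z + (j : ℂ)) = Z at *
  generalize ∏ j ∈ Finset.range (n + 1), (w + (j : ℂ)) = W at *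
  field_simp
  linear_combination hpow

/-- Bailey's summation theorem for `₂F₁(a, 1 - a; b; 1/2)`. -/
theorem tsum_gaussTerm_one_sub (a b : ℂ) (hb : ∀ n : ℕ, b ≠ -(n : ℂ)) :
    ∑' n, gaussTerm a (1 - a) b n = Gamma (b / 2) * Gamma ((b + 1) / 2) /
      (Gamma ((b + a) / 2) * Gamma ((b - a + 1) / 2)) := by
  have h1 (n : ℕ) : b / 2 ≠ -(n : ℂ) := fun h => hb (2 * n) (by
    push_cast; linear_combination 2 * h)
  have h2 (n : ℕ) : (b + 1) / 2 ≠ -(n : ℂ) := fun h => hb (2 * n + 1) (by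
    push_cast; linear_combination 2 * h)
  have h := (tendsto_prod_div_of_add_eq h1 h2 (z := (b + a) / 2) (w := (b - a + 1) / 2)
    (by ring)).mul ((tendsto_tsum_gaussTerm a (1 - a) b).comp (tendsto_add_atTop_nat 1))
  rw [mul_one] at h
  refine tendsto_nhds_unique (tendsto_const_nhds.congr fun n => ?_) h
  exact tsum_gaussTerm_eq_prod a b hb (n + 1)

end Bailey

section LaplaceTransform

/-- The kernel `exp (-s t) t ^ (p - 1)` of the Laplace transform. -/
noncomputable def laplaceKernel (p s : ℂ) (t : ℝ) : ℂ :=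
  Complex.exp (-(s * t)) * (t : ℂ) ^ (p - 1)

lemma norm_exp_mul_ofReal (z : ℂ) (t : ℝ) : ‖Complex.exp (z * t)‖ = Real.exp (z.re * t) := by
  simp [Complex.norm_exp]

lemma norm_laplaceKernel (p s : ℂ) {t : ℝ} (ht : 0 < t) :
    ‖laplaceKernel p s t‖ = t ^ (p.re - 1) * Real.exp (-(s.re * t)) := by
  rw [laplaceKernel, norm_mul, ← neg_mul, norm_exp_mul_ofReal, norm_cpow_eq_rpow_re_of_pos ht]
  simp [mul_comm]

lemma integrableOn_rpow_mul_exp_neg {q σ : ℝ} (hq : 0 < q) (hσ : 0 < σ) :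
    IntegrableOn (fun t : ℝ => t ^ (q - 1) * Real.exp (-(σ * t))) (Ioi 0) := by
  simpa using integrableOn_rpow_mul_exp_neg_mul_rpow (s := q - 1) (p := 1) (b := σ)
    (by linarith) one_pos hσ

lemma aestronglyMeasurable_laplaceKernel (p s : ℂ) :
    AEStronglyMeasurable (laplaceKernel p s) (volume.restrict (Ioi 0)) := by
  refine ContinuousOn.aestronglyMeasurable (fun t ht => ?_) measurableSet_Ioi
  have : ContinuousAt (fun t : ℝ => (t : ℂ) ^ (p - 1)) t :=
    continuousAt_ofReal_cpow_const _ _ (Or.inr (ne_of_gt ht))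
  unfold laplaceKernel
  exact (ContinuousAt.mul (by fun_prop) this).continuousWithinAt

lemma integrableOn_laplaceKernel {p s : ℂ} (hp : 0 < p.re) (hs : 0 < s.re) :
    IntegrableOn (laplaceKernel p s) (Ioi 0) := by
  refine (integrableOn_rpow_mul_exp_neg hp hs).mono' (aestronglyMeasurable_laplaceKernel p s) ?_
  filter_upwards [ae_restrict_mem measurableSet_Ioi] with t ht
  exact (norm_laplaceKernel p s ht).le

lemma hasDerivAt_integral_laplaceKernel {p s : ℂ} (hp : 0 < p.re) (hs : 0 < s.re) :
    HasDerivAt (fun s => ∫ t in Ioi (0 : ℝ), laplaceKernel p s t)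
      (∫ t in Ioi (0 : ℝ), -(t : ℂ) * laplaceKernel p s t) s := by
  set U : Set ℂ := {z | s.re / 2 < z.re} with hU
  have hU_nhds : U ∈ 𝓝 s :=
    (isOpen_lt continuous_const Complex.continuous_re).mem_nhds (by simp; linarith)
  refine (hasDerivAt_integral_of_dominated_loc_of_deriv_le (s := U)
    (bound := fun t => t ^ (p.re + 1 - 1) * Real.exp (-(s.re / 2 * t)))
    (F' := fun z t => -(t : ℂ) * laplaceKernel p z t) hU_nhds
    (Eventually.of_forall fun z => aestronglyMeasurable_laplaceKernel p z)
    (integrableOn_laplaceKernel hp hs) ?_ ?_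
    (integrableOn_rpow_mul_exp_neg (by linarith) (by linarith)) ?_).2
  · exact (by fun_prop : Continuous fun t : ℝ => -(t : ℂ)).aestronglyMeasurable.mul
      (aestronglyMeasurable_laplaceKernel p s)
  · filter_upwards [ae_restrict_mem measurableSet_Ioi] with t ht z hz
    have ht' : (0 : ℝ) < t := ht
    rw [norm_mul, norm_laplaceKernel p z ht, norm_neg, Complex.norm_real, Real.norm_of_nonneg ht'.le,
      show p.re + 1 - 1 = (p.re - 1) + 1 by ring, Real.rpow_add_one ht'.ne']
    have : Real.exp (-(z.re * t)) ≤ Real.exp (-(s.re / 2 * t)) := by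
      have : s.re / 2 < z.re := hz
      gcongr
    calc _ = t ^ (p.re - 1) * t * Real.exp (-(z.re * t)) := by ring
      _ ≤ _ := by gcongr
  · refine Eventually.of_forall fun t z _ => ?_
    have := (((hasDerivAt_id z).mul_const (t : ℂ)).neg.cexp).mul_const ((t : ℂ) ^ (p - 1))
    refine this.congr_deriv ?_
    simp [laplaceKernel]
    ring

lemma integral_laplaceKernel {p s : ℂ} (hp : 0 < p.re) (hs : 0 < s.re) :
    ∫ t in Ioi (0 : ℝ), laplaceKernel p s t = s ^ (-p) * Gamma p := by
  set U : Set ℂ := {z | 0 < z.re} with hU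
  have hUo : IsOpen U := isOpen_lt continuous_const Complex.continuous_re
  have hf : AnalyticOnNhd ℂ (fun s => ∫ t in Ioi (0 : ℝ), laplaceKernel p s t) U :=
    DifferentiableOn.analyticOnNhd (fun z hz =>
      (hasDerivAt_integral_laplaceKernel hp hz).differentiableAt.differentiableWithinAt) hUo
  have hg : AnalyticOnNhd ℂ (fun s => s ^ (-p) * Gamma p) U := by
    refine DifferentiableOn.analyticOnNhd (fun z hz => ?_) hUo
    exact (DifferentiableAt.mul_const (differentiableAt_id.cpow_const (Or.inl hz))
      _).differentiableWithinAt
  have hconn : IsPreconnected U := (convex_halfSpace_re_gt 0).isPreconnected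
  refine hf.eqOn_of_preconnected_of_frequently_eq hg hconn (z₀ := 1) (by simp [hU]) ?_ hs
  have hreal (r : ℝ) (hr : 0 < r) : (fun s => ∫ t in Ioi (0 : ℝ), laplaceKernel p s t) (r : ℂ) =
      (fun s : ℂ => s ^ (-p) * Gamma p) (r : ℂ) := by
    have := integral_cpow_mul_exp_neg_mul_Ioi hp hr
    simp only [laplaceKernel]
    simp_rw [mul_comm (cexp _)]
    rw [this, one_div, inv_cpow _ _ (by rw [arg_ofReal_of_nonneg hr.le]; exact Real.pi_pos.ne),
      cpow_neg]
  have ht : Tendsto (fun r : ℝ => (r : ℂ)) (𝓝[≠] 1) (𝓝[≠] 1) := by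
    refine tendsto_nhdsWithin_iff.2 ⟨?_, ?_⟩
    · have : Tendsto (fun r : ℝ => (r : ℂ)) (𝓝 1) (𝓝 1) := by
        simpa using Complex.continuous_ofReal.tendsto 1
      exact this.mono_left nhdsWithin_le_nhds
    · filter_upwards [self_mem_nhdsWithin] with r hr
      simpa using hr
  refine ht.frequently (Eventually.frequently ?_)
  filter_upwards [nhdsWithin_le_nhds (Ioi_mem_nhds one_pos)] with r hr
  exact hreal r hr

lemma mul_ofReal_cpow {s : ℂ} (hs : s ≠ 0) {r : ℝ} (hr : 0 < r) (p : ℂ) :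
    (s * r) ^ p = s ^ p * (r : ℂ) ^ p := by
  have hr' : (r : ℂ) ≠ 0 := by exact_mod_cast hr.ne'
  rw [cpow_def_of_ne_zero (mul_ne_zero hs hr'), cpow_def_of_ne_zero hs, cpow_def_of_ne_zero hr',
    mul_comm s, log_ofReal_mul hr hs, ofReal_log hr.le, ← Complex.exp_add]
  ring_nf

/-- `f (s t / 2)` has convergent Laplace transforms against `t ^ (p - 1)` which depend on `s` in
the right half-plane only through the factor `s ^ (-p)`. -/
def LaplaceHomogeneous (f : ℂ → ℂ) : Prop :=
  ∀ p : ℂ, 0 < p.re → ∃ J : ℂ, ∀ s : ℂ, 0 < s.re →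
    IntegrableOn (fun t : ℝ => laplaceKernel p s t * f (s * t / 2)) (Ioi 0) ∧
      ∫ t in Ioi (0 : ℝ), laplaceKernel p s t * f (s * t / 2) = s ^ (-p) * J

lemma LaplaceHomogeneous.add {f g : ℂ → ℂ} (hf : LaplaceHomogeneous f)
    (hg : LaplaceHomogeneous g) : LaplaceHomogeneous fun z => f z + g z := by
  intro p hp
  obtain ⟨J, hJ⟩ := hf p hp
  obtain ⟨K, hK⟩ := hg p hp
  refine ⟨J + K, fun s hs => ?_⟩
  simp only [mul_add]
  refine ⟨(hJ s hs).1.add (hK s hs).1, ?_⟩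
  rw [integral_add (hJ s hs).1 (hK s hs).1, (hJ s hs).2, (hK s hs).2]

lemma LaplaceHomogeneous.const_mul {f : ℂ → ℂ} (hf : LaplaceHomogeneous f) (c : ℂ) :
    LaplaceHomogeneous fun z => c * f z := by
  intro p hp
  obtain ⟨J, hJ⟩ := hf p hp
  refine ⟨c * J, fun s hs => ?_⟩
  simp only [mul_left_comm _ c]
  refine ⟨(hJ s hs).1.const_mul c, ?_⟩
  rw [integral_const_mul, (hJ s hs).2]

lemma LaplaceHomogeneous.id_mul {f : ℂ → ℂ} (hf : LaplaceHomogeneous f) :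
    LaplaceHomogeneous fun z => z * f z := by
  intro p hp
  obtain ⟨J, hJ⟩ := hf (p + 1) (by simp; linarith)
  refine ⟨J / 2, fun s hs => ?_⟩
  have hs0 : s ≠ 0 := by rintro rfl; simp at hs
  have heq : EqOn (fun t : ℝ => s / 2 * (laplaceKernel (p + 1) s t * f (s * t / 2)))
      (fun t : ℝ => laplaceKernel p s t * (s * t / 2 * f (s * t / 2))) (Ioi 0) := by
    intro t ht
    have ht' : (t : ℂ) ≠ 0 := by exact_mod_cast (ne_of_gt ht)
    simp only [laplaceKernel]
    rw [show p + 1 - 1 = (p - 1) + 1 by ring, cpow_add _ _ ht', cpow_one]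
    ring
  refine ⟨IntegrableOn.congr_fun ((hJ s hs).1.const_mul (s / 2)) heq measurableSet_Ioi, ?_⟩
  rw [← setIntegral_congr_fun measurableSet_Ioi heq, integral_const_mul, (hJ s hs).2,
    show -p = -(p + 1) + 1 by ring, cpow_add _ _ hs0, cpow_one]
  ring

lemma laplaceHomogeneous_integral_exp {g : ℝ → ℂ} (hg : IntervalIntegrable g volume 0 1) :
    LaplaceHomogeneous fun z => ∫ u in (0 : ℝ)..1, Complex.exp (z * u) * g u := by
  rw [intervalIntegrable_iff_integrableOn_Ioc_of_le zero_le_one] at hg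
  intro p hp
  refine ⟨∫ u in Ioc (0 : ℝ) 1, ((1 - u / 2 : ℝ) : ℂ) ^ (-p) * Gamma p * g u, fun s hs => ?_⟩
  have hs0 : s ≠ 0 := by rintro rfl; simp at hs
  simp only [intervalIntegral.integral_of_le zero_le_one]
  set Φ : ℝ × ℝ → ℂ := fun x =>
    laplaceKernel p s x.1 * (Complex.exp (s * x.1 / 2 * x.2) * g x.2) with hΦ
  have hΦ_int : Integrable Φ ((volume.restrict (Ioi 0)).prod (volume.restrict (Ioc 0 1))) := by
    have h1 := (integrableOn_laplaceKernel hp hs).mul_prod hg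
    have h2 := Integrable.mul_prod (integrableOn_rpow_mul_exp_neg hp (half_pos hs)) hg.norm
    refine h2.mono' ?_ ?_
    · refine (h1.aestronglyMeasurable.mul (by fun_prop : Continuous fun x : ℝ × ℝ =>
        Complex.exp (s * x.1 / 2 * x.2)).aestronglyMeasurable).congr
        (Eventually.of_forall fun x => ?_)
      simp only [hΦ, Pi.mul_apply]
      ring
    · rw [Measure.prod_restrict]
      filter_upwards [ae_restrict_mem (measurableSet_Ioi.prod measurableSet_Ioc)] with x hx
      obtain ⟨ht, hu⟩ := hx
      have ht' : 0 < x.1 := ht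
      rw [hΦ]
      simp only [norm_mul]
      rw [norm_laplaceKernel p s ht, show s * x.1 / 2 * x.2 = s * ((x.1 / 2 * x.2 : ℝ) : ℂ) by
        push_cast; ring, norm_exp_mul_ofReal, ← mul_assoc, mul_assoc (x.1 ^ _), ← Real.exp_add]
      gcongr
      nlinarith [mul_le_mul_of_nonneg_left hu.2 (mul_pos hs ht').le]
  constructor
  · have := hΦ_int.integral_prod_left
    simp only [hΦ, integral_const_mul] at this
    exact this
  · have hswap := integral_integral_swap (f := fun t u => Φ (t, u)) hΦ_int
    simp only [hΦ, integral_const_mul] at hswap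
    rw [hswap, ← integral_const_mul]
    refine setIntegral_congr_fun measurableSet_Ioc fun u hu => ?_
    have hr : 0 < 1 - u / 2 := by linarith [hu.2]
    have hre : 0 < (s * (1 - u / 2 : ℝ)).re := by
      rw [re_mul_ofReal]; exact mul_pos hs hr
    have hker : (fun t : ℝ => laplaceKernel p s t * (Complex.exp (s * t / 2 * u) * g u)) =
        fun t : ℝ => laplaceKernel p (s * (1 - u / 2 : ℝ)) t * g u := by
      funext t
      simp only [laplaceKernel]
      rw [show -(s * ((1 - u / 2 : ℝ) : ℂ) * t) = -(s * t) + s * t / 2 * u by push_cast; ring,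
        Complex.exp_add]
      ring
    rw [hker, integral_mul_const, integral_laplaceKernel hp hre, mul_ofReal_cpow hs0 hr]
    ring

end LaplaceTransform

section Kummer

/-- Kummer's confluent hypergeometric function `₁F₁(a; b; z)`. -/
noncomputable def kummer (a b z : ℂ) : ℂ :=
  ∑' n : ℕ, poch a n / (poch b n * n.factorial) * z ^ n

lemma kummerTerm_succ (a b z : ℂ) (n : ℕ) :
    poch a (n + 1) / (poch b (n + 1) * (n + 1).factorial) * z ^ (n + 1) =
      ((a + n) / (b + n) * ((1 + (n : ℂ))⁻¹ * z)) *
        (poch a n / (poch b n * n.factorial) * z ^ n) := by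
  simp only [poch_succ, Nat.factorial_succ, pow_succ, Nat.cast_mul, Nat.cast_succ,
    div_eq_mul_inv, mul_inv]
  ring_nf

lemma summable_kummerTerm (a b z : ℂ) :
    Summable fun n : ℕ => poch a n / (poch b n * n.factorial) * z ^ n :=
  summable_of_eventually_eq_mul (l := 1 * (0 * z)) (by simp)
    ((tendsto_add_div_add_natCast a b).mul ((tendsto_inv_add_natCast 1).mul_const z))
    (Eventually.of_forall (kummerTerm_succ a b z))

/-- The Euler operator `z d/dz` applied to the Kummer series. -/
lemma hasSum_natCast_mul_kummerTerm (a b z : ℂ) :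
    HasSum (fun n : ℕ => (n : ℂ) * (poch a n / (poch b n * n.factorial) * z ^ n))
      (a / b * (z * kummer (a + 1) (b + 1) z)) := by
  have h := ((summable_kummerTerm (a + 1) (b + 1) z).hasSum.mul_left z).mul_left (a / b)
  rw [← hasSum_nat_add_iff' 1]
  simp only [Finset.range_one, Finset.sum_singleton, Nat.cast_zero, zero_mul, sub_zero]
  refine h.congr_fun ?_
  intro n
  have h1 : ((n : ℂ) + 1) ≠ 0 := by exact_mod_cast n.succ_ne_zero
  simp only [poch_succ_left, Nat.factorial_succ, pow_succ, Nat.cast_mul, Nat.cast_succ,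
    div_eq_mul_inv, mul_inv]
  field_simp

lemma kummer_eq_add_denom {b : ℂ} (a : ℂ) (hb : ∀ n : ℕ, b ≠ -(n : ℂ)) (z : ℂ) :
    kummer a b z = kummer a (b + 1) z +
      a / (b * (b + 1)) * (z * kummer (a + 1) (b + 1 + 1) z) := by
  have h := (summable_kummerTerm a (b + 1) z).hasSum.add
    ((hasSum_natCast_mul_kummerTerm a (b + 1) z).mul_left b⁻¹)
  have h0 : b ≠ 0 := by simpa using hb 0
  rw [kummer, div_mul_eq_div_div, div_right_comm, div_eq_inv_mul, mul_assoc,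
    ← kummer]
  refine Eq.trans (tsum_congr fun n => ?_) (h.tsum_eq.trans ?_)
  · have h1 := poch_ne_zero hb n
    have h2 := poch_ne_zero (fun n => by simpa using ne_neg_natCast_add hb 1 n) n (b := b + 1)
    have h3 := mul_poch_add_one b n
    have h4 : (n.factorial : ℂ) ≠ 0 := by exact_mod_cast n.factorial_ne_zero
    field_simp
    linear_combination poch a n * z ^ n * h3
  · simp only [kummer]

lemma kummer_eq_add_num (a b z : ℂ) :
    kummer a b z = kummer (a + 1) b z + (-b⁻¹) * (z * kummer (a + 1) (b + 1) z) := by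
  have h1 := (summable_kummerTerm (a + 1) b z).hasSum
  have h2 := (summable_kummerTerm a b z).hasSum
  have h := h1.sub h2
  rw [← hasSum_nat_add_iff' 1] at h
  have h3 := ((summable_kummerTerm (a + 1) (b + 1) z).hasSum.mul_left z).mul_left b⁻¹
  have h4 := h.unique (h3.congr_fun fun n => ?_)
  · simp only [Finset.range_one, Finset.sum_singleton, poch_zero, sub_self, sub_zero] at h4
    simp only [kummer]
    linear_combination -h4
  · have h5 : ((n : ℂ) + 1) ≠ 0 := by exact_mod_cast n.succ_ne_zero
    rw [poch_succ_left a, poch_succ (a + 1), poch_succ_left b]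
    simp only [Nat.factorial_succ, pow_succ, Nat.cast_mul, Nat.cast_succ,
      div_eq_mul_inv, mul_inv]
    field_simp
    ring

lemma Gamma_add_natCast {p : ℂ} (hp : 0 < p.re) (n : ℕ) :
    Gamma (p + n) = Gamma p * poch p n := by
  have h := Gamma_ne_zero_of_re_pos hp
  have hp' (k : ℕ) : p ≠ -(k : ℂ) := by
    rintro rfl
    simp at hp
    exact absurd hp (not_lt.2 k.cast_nonneg)
  rw [poch, ← Gamma_add_nat_div_Gamma_eq p hp', mul_div_cancel₀ _ h]

lemma kummer_eq_integral {a b : ℂ} (ha : 0 < a.re) (hab : 0 < (b - a).re) (z : ℂ) :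
    kummer a b z = (betaIntegral a (b - a))⁻¹ * ∫ u in (0 : ℝ)..1,
      Complex.exp (z * u) * ((u : ℂ) ^ (a - 1) * (1 - (u : ℂ)) ^ (b - a - 1)) := by
  have hb : 0 < b.re := by simp at hab; linarith
  have hGb := Gamma_ne_zero_of_re_pos hb
  have hG : Gamma a * Gamma (b - a) ≠ 0 :=
    mul_ne_zero (Gamma_ne_zero_of_re_pos ha) (Gamma_ne_zero_of_re_pos hab)
  have hB : betaIntegral a (b - a) = Gamma a * Gamma (b - a) / Gamma b := by
    rw [betaIntegral_eq_Gamma_mul_div _ _ ha hab, add_sub_cancel]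
  have hBn (n : ℕ) : betaIntegral (a + n) (b - a) =
      betaIntegral a (b - a) * (poch a n / poch b n) := by
    rw [betaIntegral_eq_Gamma_mul_div _ _ (by simp; positivity) hab, hB,
      show a + n + (b - a) = b + n by ring, Gamma_add_natCast ha, Gamma_add_natCast hb]
    field_simp
  have hg := (intervalIntegrable_iff_integrableOn_Ioc_of_le zero_le_one).1
    (betaIntegral_convergent ha hab)
  set g : ℝ → ℂ := fun u => (u : ℂ) ^ (a - 1) * (1 - (u : ℂ)) ^ (b - a - 1) with hg_def
  set F : ℕ → ℝ → ℂ := fun n u => z ^ n / n.factorial * ((u : ℂ) ^ n * g u) with hF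
  have hF_int (n : ℕ) : IntegrableOn (fun u : ℝ => (u : ℂ) ^ n * g u) (Ioc 0 1) := by
    refine Integrable.mono' hg.norm ((by fun_prop : Continuous fun u : ℝ =>
      (u : ℂ) ^ n).aestronglyMeasurable.mul hg.aestronglyMeasurable) ?_
    filter_upwards [ae_restrict_mem measurableSet_Ioc] with u hu
    rw [norm_mul, norm_pow, Complex.norm_real, Real.norm_of_nonneg hu.1.le]
    exact mul_le_of_le_one_left (norm_nonneg _) (pow_le_one₀ hu.1.le hu.2)
  have hF_norm (n : ℕ) : ∫ u in Ioc (0 : ℝ) 1, ‖F n u‖ ≤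
      ‖z‖ ^ n / n.factorial * ∫ u in Ioc (0 : ℝ) 1, ‖g u‖ := by
    rw [← integral_const_mul]
    refine setIntegral_mono_on ((hF_int n).const_mul _).norm (hg.norm.const_mul _)
      measurableSet_Ioc fun u hu => ?_
    simp only [hF, norm_mul, norm_div, norm_pow, Complex.norm_natCast, Complex.norm_real,
      Real.norm_of_nonneg hu.1.le]
    gcongr
    exact mul_le_of_le_one_left (norm_nonneg _) (pow_le_one₀ hu.1.le hu.2)
  have hsum : Summable fun n => ∫ u in Ioc (0 : ℝ) 1, ‖F n u‖ :=
    Summable.of_nonneg_of_le (fun n => integral_nonneg fun u => norm_nonneg _) hF_norm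
      ((Real.summable_pow_div_factorial ‖z‖).mul_right _)
  have key : ∑' n, ∫ u in Ioc (0 : ℝ) 1, F n u = ∫ u in Ioc (0 : ℝ) 1, ∑' n, F n u :=
    (hasSum_integral_of_summable_integral_norm
    (fun n => (hF_int n).const_mul _) hsum).tsum_eq
  have htsum (u : ℝ) : ∑' n, F n u = Complex.exp (z * u) * g u := by
    simp only [hF, ← mul_assoc, tsum_mul_right]
    rw [Complex.exp_eq_exp_ℂ, NormedSpace.exp_eq_tsum_div]
    congr 1
    refine tsum_congr fun n => ?_
    rw [mul_pow]
    ring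
  have hterm (n : ℕ) : ∫ u in Ioc (0 : ℝ) 1, F n u =
      betaIntegral a (b - a) * (poch a n / (poch b n * n.factorial) * z ^ n) := by
    simp only [hF]
    rw [integral_const_mul]
    have : ∫ u in Ioc (0 : ℝ) 1, (u : ℂ) ^ n * g u = betaIntegral (a + n) (b - a) := by
      rw [betaIntegral, intervalIntegral.integral_of_le zero_le_one]
      refine setIntegral_congr_fun measurableSet_Ioc fun u hu => ?_
      have hu' : (u : ℂ) ≠ 0 := by exact_mod_cast hu.1.ne'
      simp only [hg_def]
      rw [show a + n - 1 = (a - 1) + n by ring, cpow_add _ _ hu', cpow_natCast]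
      ring
    rw [this, hBn]
    field_simp
  simp_rw [htsum, hterm, tsum_mul_left] at key
  rw [intervalIntegral.integral_of_le zero_le_one, ← key, kummer, inv_mul_cancel_left₀]
  rw [hB]
  exact div_ne_zero hG hGb

lemma laplaceHomogeneous_kummer_of_re_pos (n : ℕ) :
    ∀ {a b : ℂ}, 0 < a.re → (∀ k : ℕ, b ≠ -(k : ℂ)) → -(n : ℝ) < (b - a).re →
      LaplaceHomogeneous (kummer a b) := by
  induction n with
  | zero =>
    intro a b ha hb hab
    have hab' : 0 < (b - a).re := by simpa using hab
    have := (laplaceHomogeneous_integral_exp (betaIntegral_convergent ha hab')).const_mul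
      (betaIntegral a (b - a))⁻¹
    rwa [← funext (kummer_eq_integral ha hab')] at this
  | succ n ih =>
    intro a b ha hb hab
    have hb1 : ∀ k : ℕ, b + 1 ≠ -(k : ℂ) := by simpa using ne_neg_natCast_add hb 1
    have hb2 : ∀ k : ℕ, b + 1 + 1 ≠ -(k : ℂ) := by simpa using ne_neg_natCast_add hb1 1
    push_cast at hab
    simp only [sub_re] at hab
    rw [funext (kummer_eq_add_denom a hb)]
    refine (ih ha hb1 ?_).add ((ih ?_ hb2 ?_).id_mul.const_mul _) <;> simp <;> linarith

lemma laplaceHomogeneous_kummer_of_neg_lt_re (n : ℕ) :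
    ∀ {a b : ℂ}, -(n : ℝ) < a.re → (∀ k : ℕ, b ≠ -(k : ℂ)) →
      LaplaceHomogeneous (kummer a b) := by
  induction n with
  | zero =>
    intro a b ha hb
    obtain ⟨m, hm⟩ := exists_nat_gt (-(b - a).re)
    exact laplaceHomogeneous_kummer_of_re_pos m (by simpa using ha) hb (by linarith)
  | succ n ih =>
    intro a b ha hb
    have hb1 : ∀ k : ℕ, b + 1 ≠ -(k : ℂ) := by simpa using ne_neg_natCast_add hb 1
    push_cast at ha
    rw [funext (kummer_eq_add_num a b)]
    refine (ih ?_ hb).add ((ih ?_ hb1).id_mul.const_mul _) <;> simp <;> linarith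

lemma laplaceHomogeneous_kummer (a : ℂ) {b : ℂ} (hb : ∀ k : ℕ, b ≠ -(k : ℂ)) :
    LaplaceHomogeneous (kummer a b) := by
  obtain ⟨n, hn⟩ := exists_nat_gt (-a.re)
  exact laplaceHomogeneous_kummer_of_neg_lt_re n (by linarith) hb

end Kummer

section Main

lemma integral_laplaceKernel_one_mul_tsum {p : ℂ} (hp : 0 < p.re) {h : ℕ → ℂ}
    (hh : Summable fun n => h n * poch p.re n * (1 / 2) ^ n) :
    ∫ t in Ioi (0 : ℝ), laplaceKernel p 1 t * ∑' n, h n * (1 * t / 2 : ℂ) ^ n =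
      Gamma p * ∑' n, h n * poch p n * (1 / 2) ^ n := by
  have hpn (n : ℕ) : 0 < (p + n).re := by simp; positivity
  have h1 : 0 < (1 : ℂ).re := by simp
  set F : ℕ → ℝ → ℂ := fun n t => h n * (1 / 2) ^ n * laplaceKernel (p + n) 1 t with hF
  have hF_int (n : ℕ) : IntegrableOn (F n) (Ioi 0) :=
    (integrableOn_laplaceKernel (hpn n) h1).const_mul _
  have hp' : 0 < ((p.re : ℝ) : ℂ).re := by simpa using hp
  have hF_norm (n : ℕ) : ∫ t in Ioi (0 : ℝ), ‖F n t‖ =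
      ‖Gamma (p.re : ℂ)‖ * ‖h n * poch p.re n * (1 / 2) ^ n‖ := by
    simp only [hF, norm_mul]
    rw [integral_const_mul, setIntegral_congr_fun measurableSet_Ioi
      fun t ht => norm_laplaceKernel (p + n) 1 ht]
    simp only [one_re]
    rw [Real.integral_rpow_mul_exp_neg_mul_Ioi (hpn n) one_pos, div_one, Real.one_rpow, one_mul,
      ← Real.norm_of_nonneg (Real.Gamma_pos_of_pos (hpn n)).le, ← Complex.norm_real,
      ← Complex.Gamma_ofReal, add_re, natCast_re, ofReal_add, ofReal_natCast,
      Gamma_add_natCast hp', norm_mul]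
    ring
  have hsum : Summable fun n => ∫ t in Ioi (0 : ℝ), ‖F n t‖ := by
    simp_rw [hF_norm]
    exact hh.norm.mul_left _
  have key : ∑' n, ∫ t in Ioi (0 : ℝ), F n t = ∫ t in Ioi (0 : ℝ), ∑' n, F n t :=
    (hasSum_integral_of_summable_integral_norm hF_int hsum).tsum_eq
  have hterm (n : ℕ) : ∫ t in Ioi (0 : ℝ), F n t =
      Gamma p * (h n * poch p n * (1 / 2) ^ n) := by
    simp only [hF]
    rw [integral_const_mul, integral_laplaceKernel (hpn n) h1, one_cpow, one_mul,
      Gamma_add_natCast hp]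
    ring
  simp_rw [hterm, tsum_mul_left] at key
  rw [key]
  refine setIntegral_congr_fun measurableSet_Ioi fun t ht => ?_
  have ht' : (t : ℂ) ≠ 0 := by exact_mod_cast (ne_of_gt ht)
  simp only [← tsum_mul_left, hF]
  refine tsum_congr fun n => ?_
  simp only [laplaceKernel]
  rw [show p + n - 1 = (p - 1) + n by ring, cpow_add _ _ ht', cpow_natCast, one_mul,
    div_eq_mul_one_div (t : ℂ), mul_pow]
  ring

lemma hypCoeff_eq (a : ℂ) {c d : ℂ} (hd : ∀ n : ℕ, d ≠ -(n : ℂ)) (n : ℕ) :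
    (([a, d + 1].map fun a => poch a n).prod /
      (([c + 1, d].map fun b => poch b n).prod * (n.factorial : ℂ))) =
    (1 + d⁻¹ * n) * (poch a n / (poch (c + 1) n * n.factorial)) := by
  have h0 : d ≠ 0 := by simpa using hd 0
  have h1 := poch_ne_zero hd n
  have h2 : poch (d + 1) n = (1 + d⁻¹ * n) * poch d n := by
    field_simp
    linear_combination mul_poch_add_one d n
  simp only [List.map_cons, List.map_nil, List.prod_cons, List.prod_nil, mul_one, h2]
  rw [show poch a n * ((1 + d⁻¹ * n) * poch d n) = poch d n * ((1 + d⁻¹ * n) * poch a n) by ring,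
    show poch (c + 1) n * poch d n * n.factorial = poch d n * (poch (c + 1) n * n.factorial) by
      ring, mul_div_mul_left _ _ h1, mul_div_assoc]

lemma hyp_eq_kummer (a c : ℂ) {d : ℂ} (hd : ∀ n : ℕ, d ≠ -(n : ℂ)) (z : ℂ) :
    hyp [a, d + 1] [c + 1, d] z = kummer a (c + 1) z +
      d⁻¹ * (a / (c + 1)) * (z * kummer (a + 1) (c + 1 + 1) z) := by
  rw [mul_assoc, hyp]
  simp_rw [hypCoeff_eq a hd]
  refine HasSum.tsum_eq (((summable_kummerTerm a (c + 1) z).hasSum.add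
    ((hasSum_natCast_mul_kummerTerm a (c + 1) z).mul_left d⁻¹)).congr_fun fun n => ?_)
  ring

/-- The extension of Bailey's theorem to `₃F₂(a, 1 - a, d + 1; c + 1, d; 1/2)`. -/
lemma tsum_extended_bailey (a c : ℂ) {d : ℂ} (hd : d ≠ 0)
    (hc : ∀ n : ℕ, c + 1 ≠ -(n : ℂ)) :
    ∑' n : ℕ, (1 + d⁻¹ * n) * gaussTerm a (1 - a) (c + 1) n =
      Gamma (1 / 2) * Gamma (c + 1) / (2 : ℂ) ^ c *
        ((2 / d) / (Gamma ((a + c) / 2) * Gamma ((c - a + 1) / 2)) +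
          (1 - c / d) / (Gamma ((a + c + 1) / 2) * Gamma ((c - a) / 2 + 1))) := by
  have hc2 (n : ℕ) : c + 2 ≠ -(n : ℂ) := by
    have := ne_neg_natCast_add hc 1 n
    rwa [Nat.cast_one, add_assoc, one_add_one_eq_two] at this
  have hc0 : c + 1 ≠ 0 := by simpa using hc 0
  have hv := summable_gaussTerm a (1 - a) (c + 1)
  have hnv := summable_natCast_mul_gaussTerm a (1 - a) (c + 1)
  set v := gaussTerm a (1 - a) (c + 1)
  have hcv : Summable fun n : ℕ => (c + n) * v n := by
    simpa only [add_mul] using (hv.mul_left c).add hnv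
  have hsplit : ∑' n : ℕ, (1 + d⁻¹ * n) * v n =
      d⁻¹ * ∑' n : ℕ, (c + n) * v n + (1 - c / d) * ∑' n, v n := by
    rw [← tsum_mul_left, ← tsum_mul_left, ← (hcv.mul_left _).tsum_add (hv.mul_left _)]
    refine tsum_congr fun n => ?_
    field_simp
    ring
  have hpi : ((√Real.pi : ℝ) : ℂ) = Gamma (1 / 2) := by
    rw [← Real.Gamma_one_half_eq, ← Complex.Gamma_ofReal]
    norm_num
  have h2c : (2 : ℂ) ^ c ≠ 0 := by simp [cpow_eq_zero_iff]
  have hdup1 : Gamma ((c + 1) / 2) * Gamma ((c + 1 + 1) / 2) =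
      Gamma (1 / 2) * Gamma (c + 1) / (2 : ℂ) ^ c := by
    have h := Gamma_mul_Gamma_add_half ((c + 1) / 2)
    rw [show (c + 1) / 2 + 1 / 2 = (c + 1 + 1) / 2 by ring,
      show 2 * ((c + 1) / 2) = c + 1 by ring, show 1 - (c + 1) = -c by ring, cpow_neg, hpi] at h
    rw [h]
    field_simp
  have hdup2 : Gamma ((c + 2) / 2) * Gamma ((c + 2 + 1) / 2) =
      (c + 1) / 2 * (Gamma (1 / 2) * Gamma (c + 1) / (2 : ℂ) ^ c) := by
    have h0 : (c + 1) / 2 ≠ 0 := div_ne_zero hc0 two_ne_zero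
    have h := Gamma_add_one _ h0
    rw [← hdup1, show (c + 2 + 1) / 2 = (c + 1) / 2 + 1 by ring, h,
      show (c + 1 + 1) / 2 = (c + 2) / 2 by ring]
    ring
  have hB1 := tsum_gaussTerm_one_sub a (c + 1) hc
  have hB2 := tsum_gaussTerm_one_sub a (c + 2) hc2
  have hrec := add_one_mul_tsum_gaussTerm a c hc
  rw [hdup1] at hB1
  rw [hdup2] at hB2
  have hG1 := one_div_Gamma_eq_self_mul_one_div_Gamma_add_one ((a + c) / 2)
  have hG2 := one_div_Gamma_eq_self_mul_one_div_Gamma_add_one ((c - a + 1) / 2)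
  rw [show (a + c) / 2 + 1 = (c + 2 + a) / 2 by ring] at hG1
  rw [show (c - a + 1) / 2 + 1 = (c + 2 - a + 1) / 2 by ring] at hG2
  have hψ : ∑' n : ℕ, (c + n) * v n = Gamma (1 / 2) * Gamma (c + 1) / (2 : ℂ) ^ c *
      (2 / (Gamma ((a + c) / 2) * Gamma ((c - a + 1) / 2))) := by
    apply mul_left_cancel₀ hc0
    rw [hrec, hB2, div_eq_mul_inv _ (Gamma _ * Gamma _), div_eq_mul_inv _ (Gamma _ * Gamma _),
      mul_inv, mul_inv, hG1, hG2]
    ring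
  rw [hsplit, hψ, hB1, show (c + 1 + a) / 2 = (a + c + 1) / 2 by ring,
    show (c + 1 - a + 1) / 2 = (c - a) / 2 + 1 by ring]
  ring

end Main

theorem stmt17 (a c d s : ℂ) (ha : 0 < (1 - a).re) (hd : 0 < d.re)
    (hs : 0 < s.re) (h₁ : (∀ n : ℕ, c + 1 ≠ -(n : ℂ))) (h₂ : (∀ n : ℕ, d ≠ -(n : ℂ))) :
    ∫ t in Ioi (0:ℝ), Complex.exp (-(s * t)) * (t : ℂ) ^ (-a) *
        hyp [a, d + 1] [c + 1, d] (s * t / 2)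
      = s ^ (a - 1) * Complex.Gamma (1/2) * Complex.Gamma (1 - a) * Complex.Gamma (c + 1) / (2 : ℂ) ^ c *
          ((2 / d) / (Complex.Gamma ((a + c) / 2) * Complex.Gamma ((c - a + 1) / 2)) +
            (1 - c / d) / (Complex.Gamma ((a + c + 1) / 2) * Complex.Gamma ((c - a) / 2 + 1))) := by
  have hd0 : d ≠ 0 := by simpa using h₂ 0
  have hc2 : ∀ k : ℕ, c + 1 + 1 ≠ -(k : ℂ) := by simpa using ne_neg_natCast_add h₁ 1
  have hLH : LaplaceHomogeneous (hyp [a, d + 1] [c + 1, d]) := by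
    rw [funext (hyp_eq_kummer a c h₂)]
    exact (laplaceHomogeneous_kummer a h₁).add
      ((laplaceHomogeneous_kummer (a + 1) hc2).id_mul.const_mul _)
  obtain ⟨J, hJ⟩ := hLH (1 - a) ha
  have hJ1 := (hJ 1 (by simp)).2
  rw [one_cpow, one_mul] at hJ1
  have hterm (p : ℂ) (n : ℕ) : (1 + d⁻¹ * n) * (poch a n / (poch (c + 1) n * n.factorial)) *
      poch p n * (1 / 2) ^ n = (1 + d⁻¹ * n) * gaussTerm a p (c + 1) n := by
    simp only [gaussTerm]
    ring
  have hsum : Summable fun n : ℕ => (1 + d⁻¹ * n) *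
      (poch a n / (poch (c + 1) n * n.factorial)) * poch ((1 - a).re : ℂ) n * (1 / 2) ^ n := by
    simp_rw [hterm, add_mul, one_mul, mul_assoc]
    exact (summable_gaussTerm _ _ _).add ((summable_natCast_mul_gaussTerm _ _ _).mul_left _)
  have h_one := integral_laplaceKernel_one_mul_tsum ha hsum
  simp_rw [hterm] at h_one
  rw [tsum_extended_bailey a c hd0 h₁] at h_one
  simp_rw [← hypCoeff_eq a h₂] at h_one
  have hJ_eq := hJ1.symm.trans h_one
  have hs_int := (hJ s hs).2
  rw [hJ_eq] at hs_int
  simp only [laplaceKernel] at hs_int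
  rw [show 1 - a - 1 = -a by ring, show -(1 - a) = a - 1 by ring] at hs_int
  rw [hs_int]
  ring
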